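/- For every α > 0 and every finite set Ω there exist γ > 0 and n₀ such that for all n > n₀ the following holds. Let μ be a probability measure on Ω^n, let U ⊆ [n] be nonempty, and let μ̄ ∈ P(Ω). If μ is γ-regular on U and ⟨‖σ[·|U] − μ̄‖_TV⟩_μ < 2γ, then the product measure μ ⊗ μ, regarded as a probability measure on (Ω × Ω)^n by pairing the i-th coordinates of the two copies, is α-regular on U (with Ω replaced by Ω × Ω in the definition of regularity). -/

import Mathlib

open Finset

noncomputable section

/-- `μ` is a probability mass function on the finite type `X`. -/
def IsPMF {X : Type*} [Fintype X] (μ : X → ℝ) : Prop :=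
  (∀ x, 0 ≤ μ x) ∧ ∑ x, μ x = 1

/-- Total variation distance between two mass functions (half the `L¹` distance,
so that `‖ν − ν'‖_TV = max_A |ν(A) − ν'(A)|` for probability measures). -/
def tv {X : Type*} [Fintype X] (p q : X → ℝ) : ℝ :=
  (∑ x, |p x - q x|) / 2

/-- Expectation `⟨f⟩_μ` of `f` under `μ`. -/
def expec {X : Type*} [Fintype X] (μ : X → ℝ) (f : X → ℝ) : ℝ :=
  ∑ x, μ x * f x

/-- Mass `μ(S)` of a finite set `S`. -/
def mass {X : Type*} (μ : X → ℝ) (S : Finset X) : ℝ :=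
  ∑ x ∈ S, μ x

/-- The conditional measure `μ[·|S]`. -/
def condPMF {X : Type*} [DecidableEq X] (μ : X → ℝ) (S : Finset X) (x : X) : ℝ :=
  if x ∈ S then μ x / mass μ S else 0

/-- The conditional expectation `⟨f | S⟩_μ`. -/
def condExpect {X : Type*} (μ : X → ℝ) (S : Finset X) (f : X → ℝ) : ℝ :=
  (∑ x ∈ S, μ x * f x) / mass μ S

/-- Empirical distribution `σ[·|S]` of the values of `σ` on `S`. -/
def empDist {V Ω : Type*} [DecidableEq Ω] (σ : V → Ω) (S : Finset V) (ω : Ω) : ℝ :=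
  ((S.filter fun x => σ x = ω).card : ℝ) / (S.card : ℝ)

/-- The marginal law `μ_↓x` of the coordinate `x` under `μ ∈ P(Ω^n)`. -/
def marg1 {Ω : Type*} [Fintype Ω] [DecidableEq Ω] {n : ℕ} (μ : (Fin n → Ω) → ℝ)
    (x : Fin n) (ω : Ω) : ℝ :=
  ∑ σ ∈ Finset.univ.filter (fun σ : Fin n → Ω => σ x = ω), μ σ

/-- The joint law `μ_↓(x₁,…,x_k)` of the coordinates `xs` under `μ ∈ P(Ω^n)`. -/
def margLaw {Ω : Type*} [Fintype Ω] [DecidableEq Ω] {n k : ℕ} (μ : (Fin n → Ω) → ℝ)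
    (xs : Fin k → Fin n) (τ : Fin k → Ω) : ℝ :=
  ∑ σ ∈ Finset.univ.filter (fun σ : Fin n → Ω => ∀ i, σ (xs i) = τ i), μ σ

/-- The joint law `μ_↓(x,y)` of a pair of coordinates under `μ ∈ P(Ω^n)`. -/
def pairLaw {Ω : Type*} [Fintype Ω] [DecidableEq Ω] {n : ℕ} (μ : (Fin n → Ω) → ℝ)
    (x y : Fin n) (τ : Ω × Ω) : ℝ :=
  ∑ σ ∈ Finset.univ.filter (fun σ : Fin n → Ω => σ x = τ.1 ∧ σ y = τ.2), μ σ

/-- `(1/n^k) Σ_{x₁,…,x_k} ‖μ_↓(x₁,…,x_k) − μ_↓x₁ ⊗ ⋯ ⊗ μ_↓x_k‖_TV`. -/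
def stateSum {Ω : Type*} [Fintype Ω] [DecidableEq Ω] {n : ℕ} (k : ℕ)
    (μ : (Fin n → Ω) → ℝ) : ℝ :=
  (1 / (n : ℝ) ^ k) * ∑ xs : Fin k → Fin n,
    tv (margLaw μ xs) (fun τ : Fin k → Ω => ∏ i, marg1 μ (xs i) (τ i))

/-- `S` is an `(ε,k)`-state of `μ`. -/
def IsState {Ω : Type*} [Fintype Ω] [DecidableEq Ω] {n : ℕ} (ε : ℝ) (k : ℕ)
    (μ : (Fin n → Ω) → ℝ) (S : Finset (Fin n → Ω)) : Prop :=
  0 < mass μ S ∧ stateSum k (condPMF μ S) < ε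

/-- `μ` is `(ε,k)`-symmetric. -/
def IsSymmetric {Ω : Type*} [Fintype Ω] [DecidableEq Ω] {n : ℕ} (ε : ℝ) (k : ℕ)
    (μ : (Fin n → Ω) → ℝ) : Prop :=
  stateSum k μ < ε

/-- A partition of a type `X` into finitely many nonempty finite classes. -/
structure FinPartition (X : Type*) where
  k : ℕ
  part : Fin k → Finset X
  nonempty : ∀ i, (part i).Nonempty
  disj : ∀ i j, i ≠ j → Disjoint (part i) (part j)
  covers : ∀ x, ∃ i, x ∈ part i

/-- `W` refines `V`: every class of `W` is contained in a class of `V`. -/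
def FinPartition.Refines {X : Type*} (W V : FinPartition X) : Prop :=
  ∀ i, ∃ j, W.part i ⊆ V.part j

/-- `μ` is `ε`-regular on the set `U ⊆ [n]`. -/
def regularOn {Ω : Type*} [Fintype Ω] [DecidableEq Ω] {n : ℕ} (ε : ℝ)
    (μ : (Fin n → Ω) → ℝ) (U : Finset (Fin n)) : Prop :=
  ∀ S ⊆ U, ε * (U.card : ℝ) ≤ (S.card : ℝ) →
    expec μ (fun σ => tv (empDist σ S) (empDist σ U)) < ε

/-- `μ` is `ε`-regular with respect to a partition `V` of `[n]`. -/
def regularPart {Ω : Type*} [Fintype Ω] [DecidableEq Ω] {n : ℕ} (ε : ℝ)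
    (μ : (Fin n → Ω) → ℝ) (V : FinPartition (Fin n)) : Prop :=
  ∃ J : Finset (Fin V.k),
    (∑ i ∈ Finset.univ \ J, ((V.part i).card : ℝ)) < ε * n ∧
    ∀ i ∈ J, regularOn ε μ (V.part i)

/-- `μ` is `ε`-homogeneous with respect to `(V, S)`. -/
def homogeneous {Ω : Type*} [Fintype Ω] [DecidableEq Ω] {n : ℕ} (ε : ℝ)
    (μ : (Fin n → Ω) → ℝ) (V : FinPartition (Fin n)) (S : FinPartition (Fin n → Ω)) : Prop :=
  ∃ I : Finset (Fin S.k),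
    (∀ i ∈ I, 0 < mass μ (S.part i)) ∧
    (∑ i ∈ Finset.univ \ I, mass μ (S.part i)) < ε ∧
    (∀ i : Fin S.k, ∀ j : Fin V.k, ∀ σ ∈ S.part i, ∀ σ' ∈ S.part i,
       tv (empDist σ (V.part j)) (empDist σ' (V.part j)) < ε) ∧
    (∀ i ∈ I, regularPart ε (condPMF μ (S.part i)) V) ∧
    regularPart ε μ V

/-- The index `ind_μ(V)` of `μ` with respect to the partition `V`. -/
def muIndex {Ω : Type*} [Fintype Ω] [DecidableEq Ω] {n : ℕ}
    (μ : (Fin n → Ω) → ℝ) (V : FinPartition (Fin n)) : ℝ :=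
  (1 / ((Fintype.card Ω : ℝ) * n)) * ∑ ω : Ω, ∑ j : Fin V.k, ∑ x ∈ V.part j,
    expec μ (fun σ => ((if σ x = ω then (1 : ℝ) else 0) - empDist σ (V.part j) ω) ^ 2)

/-- The product measure `μ ⊗ μ`, regarded as a measure on `(Ω × Ω)^n`. -/
def tensorPMF {Ω : Type*} {n : ℕ} (μ : (Fin n → Ω) → ℝ) : (Fin n → Ω × Ω) → ℝ :=
  fun σ => μ (fun i => (σ i).1) * μ (fun i => (σ i).2)

/-- The `n`-fold product `p^{⊗n}` of `p ∈ P(Ω)`. -/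
def productPMF {Ω : Type*} [Fintype Ω] {n : ℕ} (p : Ω → ℝ) : (Fin n → Ω) → ℝ :=
  fun σ => ∏ i, p (σ i)

/-- Entropy `H(q)` of a mass function. -/
def entropy {X : Type*} [Fintype X] (q : X → ℝ) : ℝ :=
  -∑ x, q x * Real.log (q x)

/-- Kullback–Leibler divergence `KL(ν‖μ)`. -/
def klDiv {X : Type*} [Fintype X] (ν μ : X → ℝ) : ℝ :=
  ∑ x, ν x * Real.log (ν x / μ x)

/-- The `j`-th marginal `q_↓j` of `q ∈ P(Ω^d)`. -/
def margOf {Ω : Type*} [Fintype Ω] [DecidableEq Ω] {d : ℕ} (q : (Fin d → Ω) → ℝ)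
    (j : Fin d) (ω : Ω) : ℝ :=
  ∑ τ ∈ Finset.univ.filter (fun τ : Fin d → Ω => τ j = ω), q τ


theorem aux_nonneg {V Ω : Type*} [DecidableEq Ω] (σ : V → Ω) (S : Finset V) (ω : Ω) :
    0 ≤ empDist σ S ω := by
  unfold empDist; positivity

theorem aux_sum {V Ω : Type*} [Fintype Ω] [DecidableEq Ω] (σ : V → Ω) (S : Finset V) :
    ∑ ω, empDist σ S ω ≤ 1 := by
  unfold empDist
  rw [← Finset.sum_div, ← Nat.cast_sum,
    ← Finset.card_eq_sum_card_fiberwise (s := S) (t := univ) (f := σ) (by simp)]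
  exact div_self_le_one _

theorem aux_tv {V Ω : Type*} [Fintype Ω] [DecidableEq Ω] (σ : V → Ω) (S T : Finset V) :
    tv (empDist σ S) (empDist σ T) ≤ 1 := by
  have h : ∑ ω, |empDist σ S ω - empDist σ T ω| ≤ ∑ ω, (empDist σ S ω + empDist σ T ω) := by
    apply Finset.sum_le_sum
    intro ω _
    have h1 := aux_nonneg σ S ω
    have h2 := aux_nonneg σ T ω
    rw [abs_le]; constructor <;> linarith
  rw [Finset.sum_add_distrib] at h
  have h1 := aux_sum σ S
  have h2 := aux_sum σ T
  unfold tv; linarith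

theorem aux_mul {V Ω : Type*} [DecidableEq Ω] (σ τ : V → Ω) (S : Finset V) (ω ω' : Ω) :
    empDist (fun i => (σ i, τ i)) S (ω, ω')
      = empDist σ S ω * empDist τ (S.filter fun x => σ x = ω) ω' := by
  unfold empDist
  rw [Finset.filter_filter]
  simp only [Prod.mk.injEq]
  by_cases h : (S.filter fun x => σ x = ω).card = 0
  · have h2 : (S.filter fun x => σ x = ω ∧ τ x = ω').card = 0 := by
      rw [Finset.card_eq_zero] at h ⊢
      rw [← Finset.filter_filter, h]; simp
    simp [h, h2]
  · have h' : ((S.filter fun x => σ x = ω).card : ℝ) ≠ 0 := by exact_mod_cast h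
    field_simp

theorem aux_det {V Ω : Type*} [Fintype Ω] [DecidableEq Ω] (σ τ : V → Ω) (S U : Finset V) :
    tv (empDist (fun i => (σ i, τ i)) S) (empDist (fun i => (σ i, τ i)) U)
    ≤ (∑ ω, empDist σ S ω * tv (empDist τ (S.filter fun x => σ x = ω)) (empDist τ U))
      + (∑ ω, empDist σ U ω * tv (empDist τ (U.filter fun x => σ x = ω)) (empDist τ U))
      + tv (empDist σ S) (empDist σ U) := by
  unfold tv
  rw [Fintype.sum_prod_type]
  have key : ∀ ω, ∑ ω', |empDist (fun i => (σ i, τ i)) S (ω, ω')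
        - empDist (fun i => (σ i, τ i)) U (ω, ω')|
      ≤ empDist σ S ω * (∑ x, |empDist τ (S.filter fun x => σ x = ω) x - empDist τ U x|)
      + empDist σ U ω * (∑ x, |empDist τ (U.filter fun x => σ x = ω) x - empDist τ U x|)
      + |empDist σ S ω - empDist σ U ω| := by
    intro ω
    have h1 : |empDist σ S ω - empDist σ U ω| * ∑ x, empDist τ U x
        ≤ |empDist σ S ω - empDist σ U ω| :=
      mul_le_of_le_one_right (abs_nonneg _) (aux_sum τ U)
    refine le_trans ?_ (add_le_add_right h1 _)
    rw [Finset.mul_sum, Finset.mul_sum, Finset.mul_sum, ← Finset.sum_add_distrib,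
      ← Finset.sum_add_distrib]
    apply Finset.sum_le_sum
    intro x _
    rw [aux_mul, aux_mul]
    have a1 := aux_nonneg σ S ω
    have a2 := aux_nonneg σ U ω
    have a3 := aux_nonneg τ U x
    rw [← abs_of_nonneg a1, ← abs_of_nonneg a2, ← abs_of_nonneg a3]
    simp only [← abs_mul]
    rw [abs_of_nonneg a1, abs_of_nonneg a2, abs_of_nonneg a3]
    set c := empDist σ S ω
    set d := empDist σ U ω
    set p := empDist τ (S.filter fun x => σ x = ω) x
    set q := empDist τ (U.filter fun x => σ x = ω) x
    set r := empDist τ U x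
    have e : c * p - d * q = c * (p - r) + (-(d * (q - r))) + (c - d) * r := by ring
    rw [e]
    refine (abs_add_three _ _ _).trans ?_
    rw [abs_neg]
  have := Finset.sum_le_sum (fun ω (_ : ω ∈ (univ : Finset Ω)) => key ω)
  rw [Finset.sum_add_distrib, Finset.sum_add_distrib] at this
  simp only [mul_div_assoc'] 
  rw [← Finset.sum_div, ← Finset.sum_div]
  linarith

theorem aux_exp {Ω : Type*} [Fintype Ω] [DecidableEq Ω] {n : ℕ} (μ : (Fin n → Ω) → ℝ)
    (f : (Fin n → Ω × Ω) → ℝ) :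
    expec (tensorPMF μ) f = ∑ σ, μ σ * expec μ (fun τ => f (fun i => (σ i, τ i))) := by
  unfold expec tensorPMF
  simp only [Finset.mul_sum]
  rw [← Fintype.sum_prod_type' (f := fun σ τ => μ σ * (μ τ * f (fun i => (σ i, τ i))))]
  apply Fintype.sum_equiv (Equiv.arrowProdEquivProdArrow (Fin n) (fun _ => Ω) (fun _ => Ω))
  intro x
  simp only [Equiv.arrowProdEquivProdArrow, Equiv.coe_fn_mk, Prod.mk.eta]
  ring

theorem expec_mono {X : Type*} [Fintype X] {μ : X → ℝ} (h : IsPMF μ) {f g : X → ℝ}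
    (hfg : ∀ x, f x ≤ g x) : expec μ f ≤ expec μ g :=
  Finset.sum_le_sum fun x _ => mul_le_mul_of_nonneg_left (hfg x) (h.1 x)

theorem expec_const {X : Type*} [Fintype X] {μ : X → ℝ} (h : IsPMF μ) (c : ℝ) :
    expec μ (fun _ => c) = c := by
  unfold expec; rw [← Finset.sum_mul, h.2, one_mul]

theorem aux_term {Ω : Type*} [Fintype Ω] [DecidableEq Ω] {n : ℕ} {μ : (Fin n → Ω) → ℝ}
    (h : IsPMF μ) {U S : Finset (Fin n)} (hU : U.Nonempty) (hS : S ⊆ U) {α γ : ℝ}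
    (hα : 0 < α) (hα1 : α ≤ 1) (hγ : 0 < γ) (hr : regularOn γ μ U)
    (hc : α * (U.card : ℝ) ≤ (S.card : ℝ)) (σ : Fin n → Ω) (ω : Ω) :
    expec μ (fun τ => empDist σ S ω * tv (empDist τ (S.filter fun x => σ x = ω)) (empDist τ U))
      ≤ γ / α := by
  have hu : (0 : ℝ) < U.card := by exact_mod_cast hU.card_pos
  have hs : (0 : ℝ) < S.card := lt_of_lt_of_le (by positivity) hc
  have hle : (((S.filter fun x => σ x = ω).card : ℕ) : ℝ) ≤ S.card := by
    exact_mod_cast Finset.card_filter_le _ _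
  by_cases hb : γ * (U.card : ℝ) ≤ ((S.filter fun x => σ x = ω).card : ℝ)
  · have h1 := hr _ ((Finset.filter_subset (fun x => σ x = ω) S).trans hS) hb
    have h2 : expec μ (fun τ => empDist σ S ω *
        tv (empDist τ (S.filter fun x => σ x = ω)) (empDist τ U)) ≤ expec μ (fun τ =>
        tv (empDist τ (S.filter fun x => σ x = ω)) (empDist τ U)) := by
      apply expec_mono h
      intro τ
      apply mul_le_of_le_one_left
      · unfold tv; positivity
      · unfold empDist
        exact (div_le_one hs).2 hle
    have h3 : γ ≤ γ / α := by
      rw [le_div_iff₀ hα]; nlinarith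
    linarith
  · rw [← expec_const h (γ / α)]
    apply expec_mono h
    intro τ
    refine (mul_le_of_le_one_right (aux_nonneg _ _ _) (aux_tv _ _ _)).trans ?_
    unfold empDist
    rw [div_le_div_iff₀ hs hα]
    push Not at hb
    nlinarith

/-- regularity of `μ` on `U` with concentrated empirical distribution
implies regularity of `μ ⊗ μ` on `U`. -/
theorem stmt18 (α : ℝ) (hα : 0 < α) (Ω : Type) [Fintype Ω] [DecidableEq Ω]
    (hΩ : 2 ≤ Fintype.card Ω) :
    ∃ γ : ℝ, 0 < γ ∧ ∃ n₀ : ℕ, ∀ n : ℕ, n₀ < n →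
      ∀ μ : (Fin n → Ω) → ℝ, IsPMF μ → ∀ U : Finset (Fin n), U.Nonempty →
        ∀ μbar : Ω → ℝ, IsPMF μbar →
          regularOn γ μ U →
          expec μ (fun σ => tv (empDist σ U) μbar) < 2 * γ →
          regularOn α (tensorPMF μ) U := by
  have hK : (2 : ℝ) ≤ Fintype.card Ω := by exact_mod_cast hΩ
  set K : ℝ := (Fintype.card Ω : ℝ) with hKdef
  have hγ : 0 < α ^ 2 / (4 * K) := by positivity
  refine ⟨α ^ 2 / (4 * K), hγ, 0, ?_⟩
  intro n _ μ h U hU _ _ hr _ S hS hc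
  set γ := α ^ 2 / (4 * K) with hγd
  have hu : (0 : ℝ) < U.card := by exact_mod_cast hU.card_pos
  have hSU : (S.card : ℝ) ≤ U.card := by exact_mod_cast Finset.card_le_card hS
  have hα1 : α ≤ 1 := by
    by_contra hh
    push Not at hh
    nlinarith
  have hγe : γ / α = α / (4 * K) := by rw [hγd]; field_simp
  have hγα : γ ≤ α / 8 := by
    rw [hγd, div_le_div_iff₀ (by positivity) (by norm_num)]
    nlinarith [mul_le_mul_of_nonneg_left hα1 hα.le]
  have hS0 := hr S hS (by nlinarith)
  rw [aux_exp]
  have hσ : ∀ σ : Fin n → Ω, expec μ (fun τ => tv (empDist (fun i => (σ i, τ i)) S)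
      (empDist (fun i => (σ i, τ i)) U))
      ≤ α / 2 + tv (empDist σ S) (empDist σ U) := by
    intro σ
    refine (expec_mono h (fun τ => aux_det σ τ S U)).trans ?_
    have e : ∀ T : Finset (Fin n), T ⊆ U → α * (U.card : ℝ) ≤ (T.card : ℝ) →
        expec μ (fun τ => ∑ ω, empDist σ T ω *
          tv (empDist τ (T.filter fun x => σ x = ω)) (empDist τ U)) ≤ α / 4 := by
      intro T hT hTc
      have : expec μ (fun τ => ∑ ω, empDist σ T ω *
          tv (empDist τ (T.filter fun x => σ x = ω)) (empDist τ U))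
          = ∑ ω, expec μ (fun τ => empDist σ T ω *
          tv (empDist τ (T.filter fun x => σ x = ω)) (empDist τ U)) := by
        unfold expec
        rw [Finset.sum_comm]
        exact Finset.sum_congr rfl fun x _ => Finset.mul_sum _ _ _
      rw [this]
      refine (Finset.sum_le_sum (fun ω _ =>
        aux_term h hU hT hα hα1 hγ hr hTc σ ω)).trans ?_
      rw [Finset.sum_const, hγe, nsmul_eq_mul, Finset.card_univ, ← hKdef]
      apply le_of_eq
      field_simp
    have e1 := e S hS hc
    have e2 := e U (Finset.Subset.refl _) (by nlinarith)
    have e3 := expec_const h (tv (empDist σ S) (empDist σ U))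
    unfold expec at e1 e2 e3 ⊢
    simp only [mul_add, Finset.sum_add_distrib]
    linarith
  have h2 := expec_mono h hσ
  have h3 : expec μ (fun σ => α / 2 + tv (empDist σ S) (empDist σ U))
      = α / 2 + expec μ (fun σ => tv (empDist σ S) (empDist σ U)) := by
    have := expec_const h (α / 2)
    unfold expec at this ⊢
    simp only [mul_add, Finset.sum_add_distrib]
    rw [this]
  rw [h3] at h2
  refine lt_of_le_of_lt h2 ?_
  linarith

end
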